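/- arXiv:2205.14078 — 4 statements merged into one kernel-verified Lean document; each statement's English description precedes it below -/
import Mathlib

section
/- Let R be a commutative ring, n ∈ ℕ, x_1, …, x_{n+1} ∈ R, and t ∈ R. Then t^n = Σ_{k=0}^n h_{n−k}(x_1,…,x_{k+1}) · ∏_{i=1}^k (t − x_i), where the empty product (k = 0) equals 1. -/
open Finset

/-- The j-th complete homogeneous symmetric polynomial in x 0, ..., x (m-1). -/
noncomputable def hsym {R : Type*} [CommRing R] (x : ℕ → R) (m j : ℕ) : R :=
  ∑ t ∈ (Finset.range m).sym j, ((t : Multiset ℕ).map x).prod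

theorem hsym_z {R : Type*} [CommRing R] (x : ℕ → R) (m : ℕ) : hsym x m 0 = 1 := by
  simp [hsym]
  rfl

theorem hsym_z' {R : Type*} [CommRing R] (x : ℕ → R) (j : ℕ) : hsym x 0 (j+1) = 0 := by
  simp [hsym]

theorem hsym_rec {R : Type*} [CommRing R] (x : ℕ → R) (m j : ℕ) :
    hsym x (m+1) (j+1) = hsym x m (j+1) + x m * hsym x (m+1) j := by
  classical
  unfold hsym
  rw [← Finset.sum_filter_not_add_sum_filter _ (fun t => m ∈ t)]
  congr 1
  · apply Finset.sum_congr _ (fun _ _ => rfl)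
    ext t
    simp only [mem_filter, mem_sym_iff, mem_range]
    constructor
    · rintro ⟨h1, h2⟩ a ha
      have := h1 a ha
      have : a ≠ m := fun h => h2 (h ▸ ha)
      omega
    · intro h
      exact ⟨fun a ha => by have := h a ha; omega, fun hm => by have := h m hm; omega⟩
  · rw [Finset.mul_sum]
    symm
    refine Finset.sum_bij (fun s _ => m ::ₛ s) ?_ ?_ ?_ ?_
    · intro s hs
      simp only [mem_filter, mem_sym_iff, mem_range, Sym.mem_cons] at hs ⊢
      refine ⟨?_, by simp⟩
      rintro a (rfl | ha)
      · omega
      · exact hs a ha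
    · intro a _ b _ h
      exact Sym.cons_inj_right m a b |>.1 h
    · intro b hb
      simp only [mem_filter, mem_sym_iff, mem_range] at hb
      refine ⟨b.erase m hb.2, ?_, Sym.cons_erase hb.2⟩
      simp only [mem_sym_iff, mem_range]
      intro a ha
      exact hb.1 a (Multiset.mem_of_mem_erase ha)
    · intro s _
      simp [Sym.coe_cons]

theorem pow_eq_sum_hsym_falling {R : Type*} [CommRing R] (n : ℕ) (x : ℕ → R) (t : R) :
    t ^ n = ∑ k ∈ Finset.range (n+1),
      hsym x (k+1) (n - k) * ∏ i ∈ Finset.range k, (t - x i) := by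
  induction n with
  | zero => simp [hsym_z]
  | succ n ih =>
    have e1 : ∑ k ∈ range (n+2), hsym x k (n+1-k) * ∏ i ∈ range k, (t - x i)
        = ∑ k ∈ range (n+1), hsym x (k+1) (n-k) * ∏ i ∈ range (k+1), (t - x i) := by
      rw [Finset.sum_range_succ']
      simp [hsym_z']
    have e2 : ∑ k ∈ range (n+1), hsym x (k+1) (n+1-k) * ∏ i ∈ range k, (t - x i)
        = ∑ k ∈ range (n+1), hsym x k (n+1-k) * ∏ i ∈ range k, (t - x i)
        + ∑ k ∈ range (n+1), x k * hsym x (k+1) (n-k) * ∏ i ∈ range k, (t - x i) := by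
      rw [← Finset.sum_add_distrib]
      refine Finset.sum_congr rfl fun k hk => ?_
      have : n + 1 - k = (n - k) + 1 := by
        have := mem_range.1 hk
        omega
      rw [this, hsym_rec]
      ring
    rw [Finset.sum_range_succ, Nat.sub_self, hsym_z] at e1
    rw [Finset.sum_range_succ, e2, Nat.sub_self, hsym_z, add_right_comm, e1, pow_succ, ih,
      Finset.sum_mul, ← Finset.sum_add_distrib]
    refine Finset.sum_congr rfl fun k _ => ?_
    rw [Finset.prod_range_succ]
    ring
end

section
/- For all n, k ∈ ℕ, in the field ℚ(q) of rational functions one has q^{k²} · S_B^o[n,k] = Σ_{i=0}^k (−1)^{k−i} q^{2·C(k−i,2)} · ([k]_{q²}!/([i]_{q²}! · [k−i]_{q²}!)) · ([2i+1]_q)^n, where C(j,2) = j(j−1)/2, [m]_{q²} = 1 + q² + q⁴ + ⋯ + q^{2(m−1)}, and [k]_{q²}!/([i]_{q²}![k−i]_{q²}!) is the Gaussian binomial coefficient in the variable q². (This is the coefficient of x^n/[n]_q! in the identity Σ_{n≥0} S_B^o[n,k] x^n/[n]_q! = q^{−k²} Σ_{i=0}^k (−1)^{k−i} q^{2C(k−i,2)}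 [k choose i]_{q²} exp_q([2i+1]_q x).) -/
open Finset

/-- The q-integer [m]_q = 1 + q + ... + q^(m-1) in ℚ(q). -/
noncomputable def rq (m : ℕ) : RatFunc ℚ := ∑ i ∈ Finset.range m, RatFunc.X ^ i

/-- The q²-integer [m]_{q²} = 1 + q² + ... + q^{2(m-1)} in ℚ(q). -/
noncomputable def rq2 (m : ℕ) : RatFunc ℚ := ∑ i ∈ Finset.range m, RatFunc.X ^ (2*i)

/-- The q²-factorial [m]_{q²}! in ℚ(q). -/
noncomputable def rq2Fact (m : ℕ) : RatFunc ℚ := ∏ i ∈ Finset.range m, rq2 (i+1)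

/-- The q-double factorial [2k]_q!! = [2k]_q [2k-2]_q ⋯ [2]_q in ℚ(q). -/
noncomputable def rqDFact (k : ℕ) : RatFunc ℚ := ∏ i ∈ Finset.range k, rq (2*(i+1))

/-- Type B q-Stirling numbers of the second kind, in ℚ(q). -/
noncomputable def SBr : ℕ → ℕ → RatFunc ℚ
  | 0, k => if k = 0 then 1 else 0
  | n+1, 0 => rq 1 * SBr n 0
  | n+1, k+1 => SBr n k + rq (2*(k+1)+1) * SBr n (k+1)


theorem rq2_ne (m : ℕ) : rq2 (m+1) ≠ 0 := by
  have h : rq2 (m+1) = algebraMap (Polynomial ℚ) (RatFunc ℚ)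
      (∑ i ∈ Finset.range (m+1), Polynomial.X ^ (2*i)) := by
    simp [rq2, map_sum]
  rw [h]
  intro h0
  have h1 := (map_eq_zero_iff _ (RatFunc.algebraMap_injective ℚ)).1 h0
  have h2 := congrArg (Polynomial.eval 1) h1
  simp [Polynomial.eval_finsetSum] at h2
  have : (m : ℚ) + 1 ≠ 0 := by positivity
  exact this h2

theorem rq2Fact_ne (m : ℕ) : rq2Fact m ≠ 0 :=
  Finset.prod_ne_zero_iff.2 fun i _ => rq2_ne i

theorem rq2Fact_succ (m : ℕ) : rq2Fact (m+1) = rq2Fact m * rq2 (m+1) :=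
  Finset.prod_range_succ _ _

theorem rqDFact_succ (m : ℕ) : rqDFact (m+1) = rqDFact m * rq (2*(m+1)) :=
  Finset.prod_range_succ _ _

theorem rq_add (a b : ℕ) : rq (a+b) = rq a + RatFunc.X ^ a * rq b := by
  simp [rq, Finset.sum_range_add, pow_add, Finset.mul_sum]

theorem rq2_add (a b : ℕ) : rq2 (a+b) = rq2 a + RatFunc.X ^ (2*a) * rq2 b := by
  simp [rq2, Finset.sum_range_add, pow_add, mul_add, Finset.mul_sum]

theorem rq_two_mul (a : ℕ) : rq (2*a) = (1 + RatFunc.X) * rq2 a := by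
  induction a with
  | zero => simp [rq, rq2]
  | succ a ih =>
    have h : rq 2 = 1 + RatFunc.X := by simp [rq, Finset.sum_range_succ]
    have h' : rq2 1 = 1 := by simp [rq2]
    rw [mul_add, mul_one, rq_add, rq2_add, ih, h, h']; ring

/-- coefficients -/
noncomputable def cf (k i : ℕ) : RatFunc ℚ := (-1 : RatFunc ℚ)^(k-i) *
          RatFunc.X ^ (2 * ((k-i).choose 2)) *
          (rq2Fact k / (rq2Fact i * rq2Fact (k-i)))

theorem partial_sum (m : ℕ) : ∀ r : ℕ,
    ∑ j ∈ Finset.range (m+1), (-1 : RatFunc ℚ)^j * RatFunc.X ^ (2 * (j.choose 2)) *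
      (rq2Fact (m+r+1) / (rq2Fact j * rq2Fact (m+r+1-j)))
    = (-1)^m * RatFunc.X ^ (2 * ((m+1).choose 2)) *
      (rq2Fact (m+r) / (rq2Fact m * rq2Fact r)) := by
  induction m with
  | zero =>
    intro r
    have h0 : rq2Fact 0 = 1 := by simp [rq2Fact]
    simp [h0, rq2Fact_ne]
  | succ m ih =>
    intro r
    rw [Finset.sum_range_succ]
    have := ih (r+1)
    rw [show m + (r+1) = m+1+r by ring] at this
    rw [this, show m+1+r+1-(m+1) = r+1 by omega]
    have e1 : (m+1+1).choose 2 = (m+1) + (m+1).choose 2 := by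
      rw [Nat.choose_succ_succ' (m+1) 1, Nat.choose_one_right]
    have e2 : rq2 (m+1+r+1) = rq2 (m+1) + RatFunc.X ^ (2*(m+1)) * rq2 (r+1) := by
      rw [← rq2_add]; rfl
    rw [e1, rq2Fact_succ (m+1+r), rq2Fact_succ m, rq2Fact_succ r, e2,
      mul_add 2 (m+1) ((m+1).choose 2), pow_add _ (2*(m+1)) (2*(m+1).choose 2)]
    have := rq2Fact_ne m
    have := rq2Fact_ne r
    have := rq2_ne m
    have := rq2_ne r
    generalize (RatFunc.X : RatFunc ℚ) ^ (2*(m+1)) = A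
    generalize (RatFunc.X : RatFunc ℚ) ^ (2*(m+1).choose 2) = B
    field_simp
    ring

theorem sum_cf (k : ℕ) : ∑ i ∈ Finset.range (k+1+1), cf (k+1) i = 0 := by
  rw [← Finset.sum_range_reflect]
  have h : ∀ j ∈ Finset.range (k+1+1), cf (k+1) (k+1+1-1-j) =
      (-1 : RatFunc ℚ)^j * RatFunc.X ^ (2 * (j.choose 2)) *
      (rq2Fact (k+0+1) / (rq2Fact j * rq2Fact (k+0+1-j))) := by
    intro j hj
    have := Finset.mem_range.1 hj
    rw [cf, show k+1-(k+1+1-1-j) = j by omega, show k+1+1-1-j = k+0+1-j by omega,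
      mul_comm (rq2Fact j)]
  rw [Finset.sum_congr rfl h, Finset.sum_range_succ, partial_sum k 0]
  have h0 : rq2Fact 0 = 1 := by simp [rq2Fact]
  simp [h0, rq2Fact_ne, pow_succ]

theorem cf_step (k i : ℕ) (hi : i ≤ k) :
    cf (k+1) i * rq (2*i+1) = rq (2*(k+1)+1) * cf (k+1) i
      + RatFunc.X ^ (2*k+1) * rq (2*(k+1)) * cf k i := by
  obtain ⟨r, rfl⟩ := Nat.exists_eq_add_of_le hi
  have e : rq (2*(i+r+1)+1) = rq (2*i+1) + RatFunc.X ^ (2*i+1) * ((1+RatFunc.X) * rq2 (r+1)) := by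
    rw [← rq_two_mul, ← rq_add]; congr 1; ring
  have e1 : (r+1).choose 2 = r + r.choose 2 := by
    rw [Nat.choose_succ_succ' r 1, Nat.choose_one_right]
  rw [e, rq_two_mul, cf, cf, show i+r+1-i = r+1 by omega, show i+r-i = r by omega, e1,
    rq2Fact_succ, rq2Fact_succ]
  have := rq2Fact_ne i
  have := rq2Fact_ne r
  have := rq2_ne r
  rw [show 2*(i+r)+1 = (2*i+1) + 2*r by ring, mul_add 2 r, pow_add _ (2*i+1), pow_add _ (2*r)]
  generalize (RatFunc.X : RatFunc ℚ) ^ (2*i+1) = A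
  generalize (RatFunc.X : RatFunc ℚ) ^ (2*r) = B
  generalize (RatFunc.X : RatFunc ℚ) ^ (2*r.choose 2) = C
  generalize rq2 (i+r+1) = D
  field_simp
  ring

theorem main_aux (n : ℕ) : ∀ k : ℕ,
    RatFunc.X ^ (k^2) * (rqDFact k * SBr n k)
      = ∑ i ∈ Finset.range (k+1), cf k i * (rq (2*i+1))^n := by
  have h0 : rq2Fact 0 = 1 := by simp [rq2Fact]
  have h1 : rqDFact 0 = 1 := by simp [rqDFact]
  have h2 : rq 1 = 1 := by simp [rq]
  induction n with
  | zero =>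
    intro k
    cases k with
    | zero => simp [SBr, cf, h0, h1]
    | succ k => simp only [pow_zero, mul_one, sum_cf]; simp [SBr]
  | succ n ih =>
    intro k
    cases k with
    | zero =>
      have := ih 0
      simp [cf, h0, h1, h2] at this
      simp [SBr, cf, h0, h1, h2, this]
    | succ k =>
      have a := ih k
      have b := ih (k+1)
      have key : ∑ i ∈ Finset.range (k+1+1), cf (k+1) i * (rq (2*i+1))^(n+1)
          = rq (2*(k+1)+1) * ∑ i ∈ Finset.range (k+1+1), cf (k+1) i * (rq (2*i+1))^n
          + RatFunc.X ^ (2*k+1) * rq (2*(k+1)) *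
            ∑ i ∈ Finset.range (k+1), cf k i * (rq (2*i+1))^n := by
        rw [Finset.sum_range_succ, Finset.sum_range_succ _ (k+1), mul_add (rq _), Finset.mul_sum,
          Finset.mul_sum, add_right_comm, ← Finset.sum_add_distrib]
        congr 1
        · refine Finset.sum_congr rfl fun i hi => ?_
          have := cf_step k i (Nat.lt_succ_iff.1 (Finset.mem_range.1 hi))
          linear_combination (rq (2*i+1))^n * this
        · ring
      rw [key, ← a, ← b, SBr, rqDFact_succ]
      ring

/-- Coefficientwise form of the q-exponential generating function for the ordered
type B q-Stirling numbers S_Bᵒ[n,k] = [2k]!! S_B[n,k]. -/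
theorem SBo_qegf_coeff (n k : ℕ) :
    RatFunc.X ^ (k^2) * (rqDFact k * SBr n k)
      = ∑ i ∈ Finset.range (k+1), (-1 : RatFunc ℚ)^(k-i) *
          RatFunc.X ^ (2 * ((k-i).choose 2)) *
          (rq2Fact k / (rq2Fact i * rq2Fact (k-i))) * (rq (2*i+1))^n := by
  exact main_aux n k
end

section
/- For every n ∈ ℕ, in ℤ[q] one has Σ_{k=0}^n (−q)^{n−k} · S_B^o[n,k] = 1. -/
open Polynomial Finset

/-- The q-integer [m]_q = 1 + q + ... + q^(m-1) in ℤ[q]. -/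
noncomputable def qInt (m : ℕ) : Polynomial ℤ := ∑ i ∈ Finset.range m, Polynomial.X ^ i

/-- The q-double factorial [2k]_q!! = [2k]_q [2k-2]_q ⋯ [2]_q in ℤ[q]. -/
noncomputable def qDFact (k : ℕ) : Polynomial ℤ := ∏ i ∈ Finset.range k, qInt (2*(i+1))

/-- Type B q-Stirling numbers of the second kind. -/
noncomputable def SB : ℕ → ℕ → Polynomial ℤ
  | 0, k => if k = 0 then 1 else 0
  | n+1, 0 => qInt 1 * SB n 0
  | n+1, k+1 => SB n k + qInt (2*(k+1)+1) * SB n (k+1)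

theorem SB_zero_of_lt (n : ℕ) : ∀ k, n < k → SB n k = 0 := by
  induction n with
  | zero => intro k hk; simp only [SB]; rw [if_neg (by omega)]
  | succ n ih =>
    intro k hk
    obtain ⟨k, rfl⟩ : ∃ j, k = j + 1 := ⟨k - 1, by omega⟩
    simp only [SB]
    rw [ih k (by omega), ih (k+1) (by omega)]; simp

theorem qInt_succ_left (m : ℕ) : qInt (m+1) = 1 + Polynomial.X * qInt m := by
  unfold qInt
  rw [Finset.sum_range_succ', Finset.mul_sum, add_comm]
  simp [pow_succ']

theorem SBo_alternating_sum (n : ℕ) :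
    ∑ k ∈ Finset.range (n+1), (-Polynomial.X : Polynomial ℤ)^(n-k) * (qDFact k * SB n k)
      = 1 := by
  induction n with
  | zero => simp [SB, qDFact]
  | succ n ih =>
    have key : ∑ k ∈ Finset.range (n+1),
        (-Polynomial.X : Polynomial ℤ)^(n+1-k) * (qDFact k * (qInt (2*k+1) * SB n k))
        = ∑ k ∈ Finset.range (n+1),
        (-Polynomial.X : Polynomial ℤ)^(n+1-(k+1)) *
          (qDFact (k+1) * (qInt (2*(k+1)+1) * SB n (k+1)))
        + (-Polynomial.X : Polynomial ℤ)^(n+1) * (qDFact 0 * (qInt 1 * SB n 0)) := by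
      have h := Finset.sum_range_succ' (fun k => (-Polynomial.X : Polynomial ℤ)^(n+1-k) *
        (qDFact k * (qInt (2*k+1) * SB n k))) (n+1)
      rw [Finset.sum_range_succ, SB_zero_of_lt n (n+1) (by omega)] at h
      simpa using h
    rw [Finset.sum_range_succ']
    simp only [SB, mul_add, Finset.sum_add_distrib, Nat.sub_zero]
    simp only [mul_add] at key
    rw [add_assoc, ← key, ← Finset.sum_add_distrib, ← ih]
    refine Finset.sum_congr rfl fun k hk => ?_
    have hk' : k < n + 1 := Finset.mem_range.mp hk
    have e1 : n + 1 - k = (n - k) + 1 := by omega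
    have e2 : n + 1 - (k + 1) = n - k := by omega
    have e3 : qDFact (k+1) = qDFact k * (1 + Polynomial.X * qInt (2*k+1)) := by
      rw [← qInt_succ_left]
      unfold qDFact
      rw [Finset.prod_range_succ]
      rfl
    rw [e1, e2, e3]
    ring
end

section
/- For every integer m ≥ 1 and every n ∈ ℕ, the polynomial q^m − q divides (Σ_{k=0}^n (−1)^{n−k} q^{m(n−k)} · S^o[n,k]) − 1 in ℤ[q]. -/
open Polynomial Finset

/-- The q-factorial [m]_q! in ℤ[q]. -/
noncomputable def qFact (m : ℕ) : Polynomial ℤ := ∏ i ∈ Finset.range m, qInt (i+1)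

/-- Type A q-Stirling numbers of the second kind. -/
noncomputable def SA : ℕ → ℕ → Polynomial ℤ
  | 0, k => if k = 0 then 1 else 0
  | _+1, 0 => 0
  | n+1, k+1 => SA n k + qInt (k+1) * SA n (k+1)

lemma SA_zero_of_lt : ∀ (n k : ℕ), n < k → SA n k = 0
  | 0, k, h => by
      have : k ≠ 0 := by omega
      simp [SA, this]
  | n+1, 0, h => by omega
  | n+1, k+1, h => by
      rw [SA, SA_zero_of_lt n k (by omega), SA_zero_of_lt n (k+1) (by omega)]
      simp

lemma qInt_succ_sub (k : ℕ) : qInt (k+1) = 1 + X * qInt k := by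
  unfold qInt
  rw [Finset.sum_range_succ', Finset.mul_sum, add_comm]
  simp [pow_succ']

lemma qFact_succ' (k : ℕ) : qFact (k+1) = qFact k * qInt (k+1) := by
  unfold qFact
  rw [Finset.prod_range_succ]

lemma key (n : ℕ) : ∑ k ∈ Finset.range (n+1),
    (-X : Polynomial ℤ)^(n-k) * (qFact k * SA n k) = 1 := by
  induction n with
  | zero => simp [SA, qFact]
  | succ n ih =>
    have h1 := Finset.sum_range_succ
      (fun k => (-X : Polynomial ℤ)^(n+1-k) * (qFact k * qInt k * SA n k)) (n+1)
    rw [Finset.sum_range_succ', SA_zero_of_lt n (n+1) (by omega)] at h1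
    have h0 : qInt 0 = 0 := by simp [qInt]
    simp only [h0, mul_zero, zero_mul, add_zero, Nat.add_sub_add_right] at h1
    rw [Finset.sum_range_succ']
    simp only [SA, mul_zero, add_zero, Nat.add_sub_add_right]
    rw [← ih]
    have h2 : ∀ k ∈ Finset.range (n+1),
        (-X : Polynomial ℤ)^(n-k) * (qFact (k+1) * (SA n k + qInt (k+1) * SA n (k+1)))
        = (-X : Polynomial ℤ)^(n-k) * (qFact k * qInt (k+1) * SA n k)
          + (-X : Polynomial ℤ)^(n-k) * (qFact (k+1) * qInt (k+1) * SA n (k+1)) := by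
      intro k _
      rw [qFact_succ']
      ring
    rw [Finset.sum_congr rfl h2, Finset.sum_add_distrib, h1, ← Finset.sum_add_distrib]
    refine Finset.sum_congr rfl fun k hk => ?_
    have hk' := Finset.mem_range.mp hk
    rw [show n + 1 - k = (n - k) + 1 by omega, qInt_succ_sub]
    ring

theorem So_divisibility (m : ℕ) (hm : 1 ≤ m) (n : ℕ) :
    (Polynomial.X^m - Polynomial.X : Polynomial ℤ) ∣
      (∑ k ∈ Finset.range (n+1),
          (-1 : Polynomial ℤ)^(n-k) * Polynomial.X^(m*(n-k)) * (qFact k * SA n k)) - 1 := by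
  conv_rhs => arg 2; rw [← key n]
  rw [← Finset.sum_sub_distrib]
  refine Finset.dvd_sum fun k _ => ?_
  have e : (-1 : Polynomial ℤ)^(n-k) * X^(m*(n-k)) * (qFact k * SA n k)
      - (-X)^(n-k) * (qFact k * SA n k)
      = ((X^m)^(n-k) - X^(n-k)) * ((-1)^(n-k) * (qFact k * SA n k)) := by
    rw [neg_pow (X : Polynomial ℤ), pow_mul]
    ring
  rw [e]
  exact Dvd.dvd.mul_right (sub_dvd_pow_sub_pow _ _ _) _
end
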